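/- arXiv:2309.02154 — 2 statements merged into one kernel-verified Lean document; each statement's English description precedes it below -/
import Mathlib

section
/- Let λ, μ > 0. Then as t → 0⁺, (-log t)·∫_ℝ exp(-(t^{λ+x} + t^{μ-x})) dx - (λ+μ)·(-log t) converges to -2γ, where γ is the Euler–Mascheroni constant. -/
open MeasureTheory Filter

theorem integrable_comp_exp_iff (g : ℝ → ℝ) :
    IntegrableOn g (Set.Ioi 0) ↔ Integrable fun w => Real.exp w * g (Real.exp w) := by
  have h := integrableOn_image_iff_integrableOn_abs_deriv_smul (f := Real.exp) (f' := Real.exp)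
    MeasurableSet.univ (fun x _ => (Real.hasDerivAt_exp x).hasDerivWithinAt)
    Real.exp_injective.injOn g
  simpa [Set.image_univ, Real.range_exp, Real.abs_exp] using h

theorem integral_comp_exp (g : ℝ → ℝ) :
    ∫ x in Set.Ioi 0, g x = ∫ w, Real.exp w * g (Real.exp w) := by
  have h := integral_image_eq_integral_abs_deriv_smul (f := Real.exp) (f' := Real.exp)
    MeasurableSet.univ (fun x _ => (Real.hasDerivAt_exp x).hasDerivWithinAt)
    Real.exp_injective.injOn g
  simpa [Set.image_univ, Real.range_exp, Real.abs_exp] using h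

theorem exp_mul_gamma_integrand (s w : ℝ) :
    Real.exp w * (Real.exp (-Real.exp w) * Real.exp w ^ (s - 1)) =
      Real.exp (s * w - Real.exp w) := by
  rw [← Real.exp_mul, ← Real.exp_add, ← Real.exp_add]
  ring_nf

theorem integrable_exp_mul_sub_exp {s : ℝ} (hs : 0 < s) :
    Integrable fun w => Real.exp (s * w - Real.exp w) := by
  simpa only [exp_mul_gamma_integrand] using
    (integrable_comp_exp_iff _).1 (Real.GammaIntegral_convergent hs)

theorem integrable_exp_sub_exp : Integrable fun w => Real.exp (w - Real.exp w) := by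
  simpa using integrable_exp_mul_sub_exp one_pos

theorem integral_exp_sub_exp : ∫ w, Real.exp (w - Real.exp w) = 1 := by
  have h := Real.Gamma_eq_integral one_pos
  rw [Real.Gamma_one, integral_comp_exp] at h
  simp only [exp_mul_gamma_integrand, one_mul] at h
  exact h.symm

theorem integrable_mul_exp_sub_exp : Integrable fun w => w * Real.exp (w - Real.exp w) := by
  have h1 := (integrable_exp_mul_sub_exp (s := 3 / 2) (by norm_num)).const_mul 2
  have h2 := (integrable_exp_mul_sub_exp (s := 1 / 2) (by norm_num)).const_mul 2
  refine (h1.add h2).mono' (by fun_prop) (ae_of_all _ fun w => ?_)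
  have e1 : Real.exp (3 / 2 * w - Real.exp w) =
      Real.exp (w / 2) * Real.exp (w - Real.exp w) := by
    rw [← Real.exp_add]; ring_nf
  have e2 : Real.exp (1 / 2 * w - Real.exp w) =
      Real.exp (-(w / 2)) * Real.exp (w - Real.exp w) := by
    rw [← Real.exp_add]; ring_nf
  have hw : |w| ≤ 2 * Real.exp (w / 2) + 2 * Real.exp (-(w / 2)) := by
    have := Real.add_one_le_exp (w / 2)
    have := Real.add_one_le_exp (-(w / 2))
    have := Real.exp_pos (w / 2)
    have := Real.exp_pos (-(w / 2))
    rw [abs_le]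
    constructor <;> linarith
  simp only [Pi.add_apply, e1, e2, norm_mul, Real.norm_eq_abs, Real.abs_exp]
  calc _ ≤ _ := mul_le_mul_of_nonneg_right hw (Real.exp_pos _).le
    _ = _ := by ring

theorem integral_mul_exp_sub_exp :
    ∫ w, w * Real.exp (w - Real.exp w) = -Real.eulerMascheroniConstant := by
  have h1 : HasDerivAt Complex.Gamma
      (∫ t : ℝ in Set.Ioi 0, (t : ℂ) ^ ((1 : ℂ) - 1) * (Real.log t * Real.exp (-t))) 1 := by
    refine (Complex.hasDerivAt_GammaIntegral (s := 1) (by simp)).congr_of_eventuallyEq ?_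
    filter_upwards [(isOpen_lt continuous_const Complex.continuous_re).mem_nhds
      (show (0 : ℝ) < (1 : ℂ).re by simp)] with a ha using Complex.Gamma_eq_integral ha
  have h2 := h1.unique Complex.hasDerivAt_Gamma_one
  have h3 : ∫ t : ℝ in Set.Ioi 0, Real.log t * Real.exp (-t) =
      -Real.eulerMascheroniConstant := by
    simp only [sub_self, Complex.cpow_zero, one_mul] at h2
    have h4 : ((∫ t : ℝ in Set.Ioi 0, Real.log t * Real.exp (-t) : ℝ) : ℂ) =
        -(Real.eulerMascheroniConstant : ℂ) := by
      rw [← h2, ← integral_complex_ofReal]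
      push_cast
      rfl
    exact_mod_cast h4
  rw [integral_comp_exp] at h3
  rw [← h3]
  congr 1 with w
  rw [Real.log_exp, sub_eq_add_neg, Real.exp_add]
  ring

/-- The integrand of the Bessel-type integral `2 K₀(2 e^{-S/2})`. -/
noncomputable def besselKernel (S w : ℝ) : ℝ := Real.exp (-(Real.exp w + Real.exp (-S - w)))

@[fun_prop]
theorem continuous_besselKernel (S : ℝ) : Continuous (besselKernel S) := by
  unfold besselKernel
  fun_prop

theorem besselKernel_pos (S w : ℝ) : 0 < besselKernel S w := Real.exp_pos _

theorem besselKernel_reflect (S w : ℝ) : besselKernel S (-S - w) = besselKernel S w := by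
  simp [besselKernel, add_comm]

theorem besselKernel_le (S w : ℝ) :
    besselKernel S w ≤ Real.exp S * Real.exp (w - Real.exp w) := by
  rw [besselKernel, ← Real.exp_add, Real.exp_le_exp]
  linarith [Real.add_one_le_exp (-S - w)]

theorem exp_mul_besselKernel (S w : ℝ) :
    Real.exp w * besselKernel S w = Real.exp (w - Real.exp w) * Real.exp (-Real.exp (-S - w)) := by
  rw [besselKernel, ← Real.exp_add, ← Real.exp_add]
  ring_nf

theorem integrable_besselKernel (S : ℝ) : Integrable (besselKernel S) := by
  refine (integrable_exp_sub_exp.const_mul (Real.exp S)).mono' (by fun_prop)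
    (ae_of_all _ fun w => ?_)
  rw [Real.norm_of_nonneg (besselKernel_pos S w).le]
  exact besselKernel_le S w

theorem integrable_mul_besselKernel (S : ℝ) : Integrable fun w => w * besselKernel S w := by
  refine (integrable_mul_exp_sub_exp.norm.const_mul (Real.exp S)).mono' (by fun_prop)
    (ae_of_all _ fun w => ?_)
  simp only [norm_mul, Real.norm_of_nonneg (besselKernel_pos S w).le, Real.norm_eq_abs,
    Real.abs_exp]
  calc _ ≤ _ := mul_le_mul_of_nonneg_left (besselKernel_le S w) (abs_nonneg w)
    _ = _ := by ring

theorem integrable_exp_mul_besselKernel (S : ℝ) :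
    Integrable fun w => Real.exp w * besselKernel S w := by
  refine integrable_exp_sub_exp.mono' (by fun_prop) (ae_of_all _ fun w => ?_)
  rw [exp_mul_besselKernel, Real.norm_of_nonneg (by positivity)]
  exact mul_le_of_le_one_right (Real.exp_pos _).le
    (Real.exp_le_one_iff.2 (neg_nonpos.2 (Real.exp_pos _).le))

theorem norm_mul_exp_mul_besselKernel_le (S w : ℝ) :
    ‖w * (Real.exp w * besselKernel S w)‖ ≤ ‖w * Real.exp (w - Real.exp w)‖ := by
  rw [exp_mul_besselKernel, ← mul_assoc, norm_mul]
  refine mul_le_of_le_one_right (norm_nonneg _) ?_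
  rw [Real.norm_of_nonneg (Real.exp_pos _).le]
  exact Real.exp_le_one_iff.2 (neg_nonpos.2 (Real.exp_pos _).le)

theorem integrable_mul_exp_mul_besselKernel (S : ℝ) :
    Integrable fun w => w * (Real.exp w * besselKernel S w) :=
  integrable_mul_exp_sub_exp.norm.mono' (by fun_prop)
    (ae_of_all _ fun w => norm_mul_exp_mul_besselKernel_le S w)

theorem hasDerivAt_besselKernel (S w : ℝ) :
    HasDerivAt (besselKernel S)
      (-(Real.exp w * besselKernel S w) + Real.exp (-S - w) * besselKernel S w) w := by
  have h := ((Real.hasDerivAt_exp w).add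
    ((hasDerivAt_id w).const_sub (-S)).exp).neg.exp
  convert! h using 1
  simp [besselKernel]
  ring

theorem integral_besselKernel (S : ℝ) :
    ∫ w, besselKernel S w =
      2 * (∫ w, w * (Real.exp w * besselKernel S w)) +
        S * ∫ w, Real.exp w * besselKernel S w := by
  have i1 := integrable_mul_exp_mul_besselKernel S
  have i2 := integrable_exp_mul_besselKernel S
  have i3 : Integrable fun w => (-S - w) * (Real.exp w * besselKernel S w) := by
    convert (i2.const_mul (-S)).sub i1 using 1
    ext w
    simp only [Pi.sub_apply]
    ring
  have e (w : ℝ) : (-S - (-S - w)) * (Real.exp (-S - w) * besselKernel S (-S - w)) =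
      w * (Real.exp (-S - w) * besselKernel S w) := by
    rw [besselKernel_reflect]; ring
  have i4 : Integrable fun w => w * (Real.exp (-S - w) * besselKernel S w) := by
    simpa only [e] using i3.comp_sub_left (-S)
  have reflect : ∫ w, w * (Real.exp (-S - w) * besselKernel S w) =
      ∫ w, (-S - w) * (Real.exp w * besselKernel S w) := by
    rw [← integral_sub_left_eq_self (fun w => (-S - w) * (Real.exp w * besselKernel S w))
      volume (-S)]
    simp only [e]
  have split : (fun w => w * (-(Real.exp w * besselKernel S w) +
      Real.exp (-S - w) * besselKernel S w)) = fun w =>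
      w * (Real.exp (-S - w) * besselKernel S w) - w * (Real.exp w * besselKernel S w) := by
    ext w; ring
  have parts := integral_mul_deriv_eq_deriv_mul_of_integrable (u := fun w => w)
    (u' := fun _ => (1 : ℝ)) (fun x _ => hasDerivAt_id x)
    (fun x _ => hasDerivAt_besselKernel S x)
    (by
      change Integrable fun w => w * (-(Real.exp w * besselKernel S w) +
        Real.exp (-S - w) * besselKernel S w)
      rw [split]
      exact i4.sub i1)
    (by
      change Integrable fun w => 1 * besselKernel S w
      simpa using integrable_besselKernel S)
    (integrable_mul_besselKernel S)
  have expand : ∫ w, (-S - w) * (Real.exp w * besselKernel S w) =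
      -S * (∫ w, Real.exp w * besselKernel S w) -
        ∫ w, w * (Real.exp w * besselKernel S w) := by
    rw [← integral_const_mul, ← integral_sub (i2.const_mul _) i1]
    congr 1 with w
    ring
  rw [split, integral_sub i4 i1, reflect, expand] at parts
  simp only [one_mul] at parts
  linarith

theorem tendsto_integral_mul_exp_mul_besselKernel :
    Tendsto (fun S => ∫ w, w * (Real.exp w * besselKernel S w)) atTop
      (nhds (-Real.eulerMascheroniConstant)) := by
  rw [← integral_mul_exp_sub_exp]
  refine tendsto_integral_filter_of_dominated_convergence _
    (.of_forall fun S => by fun_prop)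
    (.of_forall fun S => ae_of_all _ fun w => norm_mul_exp_mul_besselKernel_le S w)
    integrable_mul_exp_sub_exp.norm (ae_of_all _ fun w => ?_)
  simp only [exp_mul_besselKernel]
  have h : Tendsto (fun S : ℝ => Real.exp (-S - w)) atTop (nhds 0) :=
    Real.tendsto_exp_atBot.comp (tendsto_atBot_add_const_right _ (-w) tendsto_neg_atTop_atBot)
  have h' := (Real.continuous_exp.tendsto _).comp h.neg
  simpa using (h'.const_mul (Real.exp (w - Real.exp w))).const_mul w

theorem one_sub_exp_neg_exp_le (y : ℝ) : 1 - Real.exp (-Real.exp y) ≤ Real.exp (y / 2) := by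
  rcases le_total y 0 with hy | hy
  · have h1 := Real.add_one_le_exp (-Real.exp y)
    have h2 : Real.exp y ≤ Real.exp (y / 2) := Real.exp_le_exp.2 (by linarith)
    linarith
  · have h1 := Real.exp_pos (-Real.exp y)
    have h2 : 1 ≤ Real.exp (y / 2) := Real.one_le_exp (by linarith)
    linarith

theorem one_sub_integral_exp_mul_besselKernel_mem (S : ℝ) :
    1 - ∫ w, Real.exp w * besselKernel S w ∈
      Set.Icc 0 (Real.exp (-(1 / 2) * S) * ∫ w, Real.exp (1 / 2 * w - Real.exp w)) := by
  have i := integrable_exp_mul_besselKernel S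
  have difference : 1 - ∫ w, Real.exp w * besselKernel S w =
      ∫ w, (Real.exp (w - Real.exp w) - Real.exp w * besselKernel S w) := by
    rw [integral_sub integrable_exp_sub_exp i, integral_exp_sub_exp]
  rw [difference, ← integral_const_mul]
  have e (w : ℝ) : Real.exp (w - Real.exp w) - Real.exp w * besselKernel S w =
      Real.exp (w - Real.exp w) * (1 - Real.exp (-Real.exp (-S - w))) := by
    rw [exp_mul_besselKernel]; ring
  constructor
  · refine integral_nonneg fun w => ?_
    simp only [e, Pi.zero_apply]
    exact mul_nonneg (Real.exp_pos _).le
      (sub_nonneg.2 (Real.exp_le_one_iff.2 (neg_nonpos.2 (Real.exp_pos _).le)))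
  · refine integral_mono (integrable_exp_sub_exp.sub i)
      ((integrable_exp_mul_sub_exp (by norm_num)).const_mul _) fun w => ?_
    simp only [e]
    calc _ ≤ Real.exp (w - Real.exp w) * Real.exp ((-S - w) / 2) :=
          mul_le_mul_of_nonneg_left (one_sub_exp_neg_exp_le _) (Real.exp_pos _).le
      _ = _ := by
        rw [← Real.exp_add, ← Real.exp_add]
        ring_nf

theorem tendsto_integral_besselKernel_sub :
    Tendsto (fun S => (∫ w, besselKernel S w) - S) atTop
      (nhds (-2 * Real.eulerMascheroniConstant)) := by
  have decay : Tendsto (fun S : ℝ => S * (Real.exp (-(1 / 2) * S) *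
      ∫ w, Real.exp (1 / 2 * w - Real.exp w))) atTop (nhds 0) := by
    have h := (tendsto_rpow_mul_exp_neg_mul_atTop_nhds_zero 1 (1 / 2) (by norm_num)).mul_const
      (∫ w, Real.exp (1 / 2 * w - Real.exp w))
    simpa only [Real.rpow_one, zero_mul, mul_assoc] using h
  have remainder : Tendsto (fun S : ℝ => S * (1 - ∫ w, Real.exp w * besselKernel S w)) atTop
      (nhds 0) := by
    refine tendsto_of_tendsto_of_tendsto_of_le_of_le' tendsto_const_nhds decay ?_ ?_
    · filter_upwards [eventually_ge_atTop 0] with S hS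
      exact mul_nonneg hS (one_sub_integral_exp_mul_besselKernel_mem S).1
    · filter_upwards [eventually_ge_atTop 0] with S hS
      exact mul_le_mul_of_nonneg_left (one_sub_integral_exp_mul_besselKernel_mem S).2 hS
  have h := (tendsto_integral_mul_exp_mul_besselKernel.const_mul 2).sub remainder
  rw [show -2 * Real.eulerMascheroniConstant = 2 * -Real.eulerMascheroniConstant - 0 by ring]
  refine h.congr fun S => ?_
  rw [integral_besselKernel]
  ring

theorem neg_log_mul_integral_eq (lam mu : ℝ) {t : ℝ} (ht : 0 < t) (ht1 : t < 1) :
    (-Real.log t) * (∫ x : ℝ, Real.exp (-(t ^ (lam + x) + t ^ (mu - x)))) =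
      ∫ w, besselKernel ((lam + mu) * (-Real.log t)) w := by
  have hL : 0 < -Real.log t := neg_pos.2 (Real.log_neg ht ht1)
  set L := -Real.log t with hLdef
  have e (x : ℝ) : Real.exp (-(t ^ (lam + x) + t ^ (mu - x))) =
      besselKernel ((lam + mu) * L) (L * x - L * mu) := by
    rw [besselKernel, Real.rpow_def_of_pos ht, Real.rpow_def_of_pos ht,
      show Real.log t = -L by rw [hLdef, neg_neg]]
    ring_nf
  simp only [e]
  rw [Measure.integral_comp_mul_left (fun y => besselKernel ((lam + mu) * L) (y - L * mu)) L,
    integral_sub_right_eq_self (besselKernel ((lam + mu) * L)), abs_of_pos (inv_pos.2 hL),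
    smul_eq_mul, mul_inv_cancel_left₀ hL.ne']

/-- One-dimensional (ℙ¹) mirror-symmetric Gamma conjecture. -/
theorem gamma_conjecture_P1 (lam mu : ℝ) (hl : 0 < lam) (hm : 0 < mu) :
    Tendsto (fun t : ℝ =>
        (-Real.log t) * (∫ x : ℝ, Real.exp (-(t ^ (lam + x) + t ^ (mu - x)))) -
          (lam + mu) * (-Real.log t))
      (nhdsWithin 0 (Set.Ioi 0))
      (nhds (-2 * Real.eulerMascheroniConstant)) := by
  have hS : Tendsto (fun t => (lam + mu) * (-Real.log t)) (nhdsWithin 0 (Set.Ioi 0)) atTop :=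
    (tendsto_neg_atBot_atTop.comp Real.tendsto_log_nhdsGT_zero).const_mul_atTop (by positivity)
  refine (tendsto_integral_besselKernel_sub.comp hS).congr' ?_
  filter_upwards [Ioo_mem_nhdsGT one_pos] with t ht
  rw [neg_log_mul_integral_eq lam mu ht.1 ht.2]
  rfl
end

section
/- Let λ₁, λ₂, λ₃ > 0. Then as t → 0⁺, the quantity (log t)²·∫_{ℝ²} exp(-(t^{λ₁+x₁} + t^{λ₂+x₂} + t^{λ₃-x₁-x₂})) dx₁dx₂ - ( (λ₁+λ₂+λ₃)²/2·(log t)² + 3(λ₁+λ₂+λ₃)·γ·log t ) converges to 9γ²/2 + π²/4. -/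
open MeasureTheory Filter

/-- The Mellin transform of `log ^ k * exp (-·)`, which is the `k`-th derivative of the Gamma
function on the right half-plane. -/
noncomputable def mellinLogExp (k : ℕ) (s : ℂ) : ℂ :=
  mellin (fun t : ℝ => ((Real.log t ^ k * Real.exp (-t) : ℝ) : ℂ)) s

lemma log_smul_log_pow_mul_exp (k : ℕ) :
    (fun t : ℝ => Real.log t • ((Real.log t ^ k * Real.exp (-t) : ℝ) : ℂ)) =
      fun t : ℝ => ((Real.log t ^ (k + 1) * Real.exp (-t) : ℝ) : ℂ) := by
  ext t
  rw [Complex.real_smul, ← Complex.ofReal_mul, pow_succ']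
  congr 1
  ring

lemma log_pow_mul_exp_isBigO_atTop (k : ℕ) (a : ℝ) :
    (fun t : ℝ => ((Real.log t ^ k * Real.exp (-t) : ℝ) : ℂ)) =O[atTop] (· ^ (-a)) := by
  induction k generalizing a with
  | zero =>
    have h := (isLittleO_exp_neg_mul_rpow_atTop one_pos (-a)).isBigO
    refine Asymptotics.IsBigO.of_norm_left (h.norm_left.congr_left fun t => ?_)
    rw [Complex.norm_real, pow_zero, one_mul, neg_one_mul]
  | succ k ih =>
    rw [← log_smul_log_pow_mul_exp]
    exact isBigO_rpow_top_log_smul (lt_add_one a) (ih (a + 1))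

lemma log_pow_mul_exp_isBigO_zero (k : ℕ) {b : ℝ} (hb : 0 < b) :
    (fun t : ℝ => ((Real.log t ^ k * Real.exp (-t) : ℝ) : ℂ))
      =O[nhdsWithin 0 (Set.Ioi 0)] (· ^ (-b)) := by
  induction k generalizing b with
  | zero =>
    refine Asymptotics.IsBigO.of_bound 1 ?_
    filter_upwards [Ioo_mem_nhdsGT one_pos] with t ht
    have h1 : Real.exp (-t) ≤ 1 := Real.exp_le_one_iff.mpr (by linarith [ht.1])
    have h2 : 1 ≤ t ^ (-b) := Real.one_le_rpow_of_pos_of_le_one_of_nonpos ht.1 ht.2.le (by linarith)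
    rw [pow_zero, one_mul, one_mul, Complex.norm_real, Real.norm_of_nonneg (Real.exp_pos _).le]
    exact (h1.trans h2).trans (le_abs_self _)
  | succ k ih =>
    rw [← log_smul_log_pow_mul_exp]
    exact isBigO_rpow_zero_log_smul (half_lt_self hb) (ih (half_pos hb))

lemma mellinConvergent_and_hasDerivAt (k : ℕ) {s : ℂ} (hs : 0 < s.re) :
    MellinConvergent (fun t : ℝ => ((Real.log t ^ (k + 1) * Real.exp (-t) : ℝ) : ℂ)) s ∧
      HasDerivAt (mellinLogExp k) (mellinLogExp (k + 1) s) s := by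
  have hc : LocallyIntegrableOn
      (fun t : ℝ => ((Real.log t ^ k * Real.exp (-t) : ℝ) : ℂ)) (Set.Ioi 0) := by
    refine ContinuousOn.locallyIntegrableOn ?_ measurableSet_Ioi
    refine Complex.continuous_ofReal.comp_continuousOn (ContinuousOn.mul ?_ (by fun_prop))
    exact (Real.continuousOn_log.mono fun x hx => ne_of_gt hx).pow k
  have h := mellin_hasDerivAt_of_isBigO_rpow hc (log_pow_mul_exp_isBigO_atTop k (s.re + 1))
    (lt_add_one _) (log_pow_mul_exp_isBigO_zero k (half_pos hs)) (half_lt_self hs)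
  rw [log_smul_log_pow_mul_exp] at h
  exact h

lemma mellinLogExp_zero {s : ℂ} (hs : 0 < s.re) : mellinLogExp 0 s = Complex.Gamma s := by
  rw [Complex.Gamma_eq_integral hs, Complex.GammaIntegral_eq_mellin]
  simp [mellinLogExp]

lemma integrableOn_log_pow_mul_exp (k : ℕ) :
    IntegrableOn (fun t => Real.log t ^ (k + 1) * Real.exp (-t)) (Set.Ioi 0) := by
  have h := (mellinConvergent_and_hasDerivAt k (s := 1) (by simp)).1
  simp only [MellinConvergent, sub_self, Complex.cpow_zero, one_smul] at h
  exact h.re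

lemma mellinLogExp_one (k : ℕ) :
    mellinLogExp k 1 = ((∫ t in Set.Ioi 0, Real.log t ^ k * Real.exp (-t) : ℝ) : ℂ) := by
  rw [← integral_complex_ofReal]
  simp [mellinLogExp, mellin]

lemma eventually_hasDerivAt_one_add (k : ℕ) : ∀ᶠ s : ℂ in nhds 0,
    HasDerivAt (fun s => mellinLogExp k (1 + s)) (mellinLogExp (k + 1) (1 + s)) s := by
  filter_upwards [Metric.ball_mem_nhds (0 : ℂ) one_pos] with s hs
  have h := (abs_lt.mp ((Complex.abs_re_le_norm s).trans_lt (mem_ball_zero_iff.mp hs))).1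
  have hs' : 0 < (1 + s).re := by simp; linarith
  simpa using (mellinConvergent_and_hasDerivAt k hs').2.comp_const_add 1 s

lemma eventually_hasDerivAt_one_sub (k : ℕ) : ∀ᶠ s : ℂ in nhds 0,
    HasDerivAt (fun s => mellinLogExp k (1 - s)) (-mellinLogExp (k + 1) (1 - s)) s := by
  filter_upwards [Metric.ball_mem_nhds (0 : ℂ) one_pos] with s hs
  have h := (abs_lt.mp ((Complex.abs_re_le_norm s).trans_lt (mem_ball_zero_iff.mp hs))).2
  have hs' : 0 < (1 - s).re := by simp; linarith
  simpa using (mellinConvergent_and_hasDerivAt k hs').2.comp_const_sub 1 s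

lemma eventually_reflection : ∀ᶠ s : ℂ in nhds 0,
    mellinLogExp 0 (1 + s) * mellinLogExp 0 (1 - s) * Complex.sin (Real.pi * s) = Real.pi * s := by
  filter_upwards [Metric.ball_mem_nhds (0 : ℂ) one_pos] with s hs
  have hn := mem_ball_zero_iff.mp hs
  have h := abs_lt.mp ((Complex.abs_re_le_norm s).trans_lt hn)
  rw [mellinLogExp_zero (by simp; linarith), mellinLogExp_zero (by simp; linarith)]
  rcases eq_or_ne s 0 with rfl | h0
  · simp
  have hpi : (Real.pi : ℂ) ≠ 0 := by exact_mod_cast Real.pi_ne_zero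
  have hsin : Complex.sin (Real.pi * s) ≠ 0 := by
    rw [Ne, Complex.sin_eq_zero_iff]
    rintro ⟨n, hn'⟩
    rw [mul_comm, mul_left_inj' hpi] at hn'
    rw [hn', Complex.norm_intCast] at hn
    have : n = 0 := Int.abs_lt_one_iff.mp (by exact_mod_cast hn)
    simp [this] at hn'
    exact h0 hn'
  rw [add_comm, Complex.Gamma_add_one _ h0, mul_assoc s, Complex.Gamma_mul_Gamma_one_sub,
    mul_assoc, div_mul_cancel₀ _ hsin, mul_comm]

lemma eventually_deriv_eq {f g f' g' : ℂ → ℂ} (h : ∀ᶠ s in nhds 0, f s = g s)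
    (hf : ∀ᶠ s in nhds 0, HasDerivAt f (f' s) s) (hg : ∀ᶠ s in nhds 0, HasDerivAt g (g' s) s) :
    ∀ᶠ s in nhds 0, f' s = g' s := by
  filter_upwards [h.eventually_nhds, hf, hg] with s h hf hg
  exact (hf.congr_of_eventuallyEq (EventuallyEq.symm h)).unique hg

lemma mellinLogExp_one_one : mellinLogExp 1 1 = -Real.eulerMascheroniConstant := by
  have h := (mellinConvergent_and_hasDerivAt 0 (s := 1) (by simp)).2
  refine (h.congr_of_eventuallyEq ?_).unique Complex.hasDerivAt_Gamma_one
  filter_upwards [(isOpen_lt continuous_const Complex.continuous_re).mem_nhds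
    (show (0 : ℝ) < (1 : ℂ).re by simp)] with s hs
  exact (mellinLogExp_zero hs).symm

/-- If `h s * sin (π s) = π s` near `0`, then the second derivative of `h` at `0` is `π ^ 2 / 3`. -/
lemma second_deriv_of_mul_sin_eq {h h₁ h₂ h₃ : ℂ → ℂ}
    (hd : ∀ᶠ s in nhds 0, HasDerivAt h (h₁ s) s) (hd₁ : ∀ᶠ s in nhds 0, HasDerivAt h₁ (h₂ s) s)
    (hd₂ : ∀ᶠ s in nhds 0, HasDerivAt h₂ (h₃ s) s)
    (he : ∀ᶠ s : ℂ in nhds 0, h s * Complex.sin (Real.pi * s) = Real.pi * s) :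
    h₂ 0 = Real.pi ^ 2 / 3 := by
  have hs (s : ℂ) : HasDerivAt (fun s : ℂ => Complex.sin (Real.pi * s))
      (Complex.cos (Real.pi * s) * (Real.pi * 1)) s :=
    ((hasDerivAt_id s).const_mul (Real.pi : ℂ)).csin
  have hc (s : ℂ) : HasDerivAt (fun s : ℂ => Complex.cos (Real.pi * s))
      (-Complex.sin (Real.pi * s) * (Real.pi * 1)) s :=
    ((hasDerivAt_id s).const_mul (Real.pi : ℂ)).ccos
  have e₁ := eventually_deriv_eq he
    (by filter_upwards [hd] with s a using a.mul (hs s))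
    (Eventually.of_forall fun s => (hasDerivAt_id s).const_mul (Real.pi : ℂ))
  have e₂ := eventually_deriv_eq e₁
    (by
      filter_upwards [hd, hd₁] with s a a₁
      exact (a₁.mul (hs s)).add (a.mul ((hc s).mul_const (Real.pi * 1 : ℂ))))
    (Eventually.of_forall fun s => hasDerivAt_const s _)
  have e₃ := eventually_deriv_eq e₂
    (by
      filter_upwards [hd, hd₁, hd₂] with s a a₁ a₂
      exact ((a₂.mul (hs s)).add (a₁.mul ((hc s).mul_const (Real.pi * 1 : ℂ)))).add
        ((a₁.mul ((hc s).mul_const (Real.pi * 1 : ℂ))).add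
          (a.mul (((hs s).neg.mul_const (Real.pi * 1 : ℂ)).mul_const (Real.pi * 1 : ℂ)))))
    (Eventually.of_forall fun s => hasDerivAt_const s _)
  have hpi : (Real.pi : ℂ) ≠ 0 := by exact_mod_cast Real.pi_ne_zero
  have k₁ := e₁.self_of_nhds
  have k₃ := e₃.self_of_nhds
  simp at k₁ k₃
  have k₁' : h 0 = 1 := by simpa [hpi] using k₁
  rw [k₁'] at k₃
  refine mul_left_cancel₀ hpi ?_
  linear_combination k₃ / 3

lemma mellinLogExp_two_one :
    mellinLogExp 2 1 = Real.eulerMascheroniConstant ^ 2 + Real.pi ^ 2 / 6 := by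
  have plus (k : ℕ) := eventually_hasDerivAt_one_add k
  have minus (k : ℕ) := eventually_hasDerivAt_one_sub k
  have key := second_deriv_of_mul_sin_eq
    (h := fun s => mellinLogExp 0 (1 + s) * mellinLogExp 0 (1 - s))
    (h₁ := fun s => mellinLogExp 1 (1 + s) * mellinLogExp 0 (1 - s) +
      mellinLogExp 0 (1 + s) * -mellinLogExp 1 (1 - s))
    (by filter_upwards [plus 0, minus 0] with s a b using a.mul b)
    (by
      filter_upwards [plus 0, minus 0, plus 1, minus 1] with s a b a₁ b₁
      exact (a₁.mul b).add (a.mul b₁.neg))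
    (by
      filter_upwards [plus 0, minus 0, plus 1, minus 1, plus 2, minus 2] with s a b a₁ b₁ a₂ b₂
      exact ((a₂.mul b).add (a₁.mul b₁.neg)).add ((a₁.mul b₁.neg).add (a.mul b₂.neg.neg)))
    eventually_reflection
  have h0 : mellinLogExp 0 1 = 1 := by rw [mellinLogExp_zero (by simp), Complex.Gamma_one]
  simp [h0, mellinLogExp_one_one] at key
  linear_combination key / 2

lemma integral_log_mul_exp :
    ∫ t in Set.Ioi 0, Real.log t * Real.exp (-t) = -Real.eulerMascheroniConstant := by
  have h := mellinLogExp_one_one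
  rw [mellinLogExp_one] at h
  simpa only [pow_one] using (by exact_mod_cast h :
    ∫ t in Set.Ioi 0, Real.log t ^ 1 * Real.exp (-t) = -Real.eulerMascheroniConstant)

lemma integral_log_sq_mul_exp :
    ∫ t in Set.Ioi 0, Real.log t ^ 2 * Real.exp (-t) =
      Real.eulerMascheroniConstant ^ 2 + Real.pi ^ 2 / 6 := by
  have h := mellinLogExp_two_one
  rw [mellinLogExp_one] at h
  exact_mod_cast h

/-- The standard Gumbel distribution: the law of `-log X` for a standard exponential `X`. -/
noncomputable def gumbelMeasure : Measure ℝ :=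
  ((volume.restrict (Set.Ioi 0)).withDensity fun x => ENNReal.ofReal (Real.exp (-x))).map
    fun x => -Real.log x

lemma gumbelMeasure_Iic (u : ℝ) :
    gumbelMeasure (Set.Iic u) = ENNReal.ofReal (Real.exp (-Real.exp (-u))) := by
  have hm : Measurable fun x : ℝ => -Real.log x := Real.measurable_log.neg
  rw [gumbelMeasure, Measure.map_apply hm measurableSet_Iic,
    withDensity_apply _ (hm measurableSet_Iic), Measure.restrict_restrict (hm measurableSet_Iic)]
  have hset : (fun x : ℝ => -Real.log x) ⁻¹' Set.Iic u ∩ Set.Ioi 0 = Set.Ici (Real.exp (-u)) := by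
    ext x
    simp only [Set.mem_inter_iff, Set.mem_preimage, Set.mem_Iic, Set.mem_Ioi, Set.mem_Ici]
    refine ⟨fun h => (Real.le_log_iff_exp_le h.2).mp (by linarith [h.1]), fun h => ?_⟩
    have hx := (Real.exp_pos (-u)).trans_le h
    exact ⟨by linarith [(Real.le_log_iff_exp_le hx).mpr h], hx⟩
  rw [hset, Measure.restrict_congr_set Ioi_ae_eq_Ici.symm, ← ofReal_integral_eq_lintegral_ofReal
    (integrableOn_exp_neg_Ioi _) (ae_of_all _ fun x => (Real.exp_pos _).le), integral_exp_neg_Ioi]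

instance : IsProbabilityMeasure gumbelMeasure := by
  have hm : Measurable fun x : ℝ => -Real.log x := Real.measurable_log.neg
  constructor
  rw [gumbelMeasure, Measure.map_apply hm MeasurableSet.univ, Set.preimage_univ,
    withDensity_apply _ MeasurableSet.univ, Measure.restrict_univ,
    ← ofReal_integral_eq_lintegral_ofReal (integrableOn_exp_neg_Ioi 0)
      (ae_of_all _ fun x => (Real.exp_pos _).le), integral_exp_neg_Ioi_zero, ENNReal.ofReal_one]

lemma integral_gumbelMeasure {f : ℝ → ℝ} (hf : Measurable f) :
    ∫ x, f x ∂gumbelMeasure = ∫ x in Set.Ioi 0, f (-Real.log x) * Real.exp (-x) := by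
  have hm : Measurable fun x : ℝ => -Real.log x := Real.measurable_log.neg
  rw [gumbelMeasure, integral_map hm.aemeasurable hf.aestronglyMeasurable,
    integral_withDensity_eq_integral_toReal_smul (by fun_prop) (by simp)]
  simp [ENNReal.toReal_ofReal (Real.exp_pos _).le, mul_comm]

lemma memLp_id_gumbelMeasure : MemLp (fun x : ℝ => x) 2 gumbelMeasure := by
  have hm : Measurable fun x : ℝ => -Real.log x := Real.measurable_log.neg
  rw [memLp_two_iff_integrable_sq (by fun_prop), gumbelMeasure,
    integrable_map_measure (by fun_prop) hm.aemeasurable,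
    integrable_withDensity_iff_integrable_smul' (by fun_prop) (by simp)]
  refine (integrableOn_log_pow_mul_exp 1).congr (ae_of_all _ fun x => ?_)
  simp [ENNReal.toReal_ofReal (Real.exp_pos _).le, mul_comm]

lemma integral_id_gumbelMeasure :
    ∫ x, x ∂gumbelMeasure = Real.eulerMascheroniConstant := by
  rw [integral_gumbelMeasure (f := fun x => x) (by fun_prop)]
  simp [integral_neg, integral_log_mul_exp]

lemma integral_sq_gumbelMeasure :
    ∫ x, x ^ 2 ∂gumbelMeasure = Real.eulerMascheroniConstant ^ 2 + Real.pi ^ 2 / 6 := by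
  rw [integral_gumbelMeasure (f := fun x => x ^ 2) (by fun_prop)]
  simp [integral_log_sq_mul_exp]

lemma MeasureTheory.MemLp.add_prod {α β : Type*} [MeasurableSpace α] [MeasurableSpace β]
    {μ : Measure α} {ν : Measure β} [IsProbabilityMeasure μ] [IsProbabilityMeasure ν]
    {f : α → ℝ} {g : β → ℝ} (hf : MemLp f 2 μ) (hg : MemLp g 2 ν) :
    MemLp (fun z : α × β => f z.1 + g z.2) 2 (μ.prod ν) :=
  (hf.comp_fst ν).add (hg.comp_snd μ)

lemma integral_add_prod {α β : Type*} [MeasurableSpace α] [MeasurableSpace β]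
    {μ : Measure α} {ν : Measure β} [IsProbabilityMeasure μ] [IsProbabilityMeasure ν]
    {f : α → ℝ} {g : β → ℝ} (hf : MemLp f 2 μ) (hg : MemLp g 2 ν) :
    ∫ z, (f z.1 + g z.2) ∂μ.prod ν = ∫ x, f x ∂μ + ∫ y, g y ∂ν := by
  have hf1 := hf.integrable one_le_two
  have hg1 := hg.integrable one_le_two
  rw [integral_add (hf1.comp_fst ν) (hg1.comp_snd μ)]
  simp [integral_fun_fst, integral_fun_snd]

lemma integral_add_sq_prod {α β : Type*} [MeasurableSpace α] [MeasurableSpace β]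
    {μ : Measure α} {ν : Measure β} [IsProbabilityMeasure μ] [IsProbabilityMeasure ν]
    {f : α → ℝ} {g : β → ℝ} (hf : MemLp f 2 μ) (hg : MemLp g 2 ν) :
    ∫ z, (f z.1 + g z.2) ^ 2 ∂μ.prod ν =
      ∫ x, f x ^ 2 ∂μ + 2 * ((∫ x, f x ∂μ) * ∫ y, g y ∂ν) + ∫ y, g y ^ 2 ∂ν := by
  have hf1 := hf.integrable one_le_two
  have hg1 := hg.integrable one_le_two
  have hf2 := (memLp_two_iff_integrable_sq hf.1).mp hf
  have hg2 := (memLp_two_iff_integrable_sq hg.1).mp hg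
  have hfg : Integrable (fun z : α × β => f z.1 ^ 2 + 2 * (f z.1 * g z.2)) (μ.prod ν) :=
    (hf2.comp_fst ν).add ((hf1.mul_prod hg1).const_mul 2)
  simp_rw [add_sq, mul_assoc]
  rw [integral_add hfg (hg2.comp_snd μ),
    integral_add (hf2.comp_fst ν) ((hf1.mul_prod hg1).const_mul 2), integral_const_mul,
    integral_prod_mul]
  rw [integral_fun_fst (fun x => f x ^ 2), integral_fun_snd (fun y => g y ^ 2)]
  simp

/-- For a square integrable `X`, the error in `𝔼 (M - X)₊² = 𝔼 (M - X)² + o(1)` as `M → ∞`. -/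
lemma tendsto_integral_posPart_sq {α : Type*} [MeasurableSpace α] {P : Measure α}
    [IsProbabilityMeasure P] {X : α → ℝ} (hX : MemLp X 2 P) :
    Tendsto (fun M : ℝ => ∫ a, max (M - X a) 0 ^ 2 / 2 ∂P - (M ^ 2 / 2 - M * ∫ a, X a ∂P))
      atTop (nhds ((∫ a, X a ^ 2 ∂P) / 2)) := by
  have hX1 := hX.integrable one_le_two
  have hX2 := (memLp_two_iff_integrable_sq hX.1).mp hX
  have hmeas (M : ℝ) : AEStronglyMeasurable (fun a => max (X a - M) 0 ^ 2 / 2) P := by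
    have := hX.1.aemeasurable
    exact AEMeasurable.aestronglyMeasurable (by fun_prop)
  have hbound : ∀ M : ℝ, 0 ≤ M → ∀ a, ‖max (X a - M) 0 ^ 2 / 2‖ ≤ X a ^ 2 := by
    intro M hM a
    rw [Real.norm_of_nonneg (by positivity)]
    rcases le_total (X a - M) 0 with h | h
    · rw [max_eq_right h]
      nlinarith [sq_nonneg (X a)]
    · rw [max_eq_left h]
      nlinarith
  have hlim : Tendsto (fun M : ℝ => ∫ a, max (X a - M) 0 ^ 2 / 2 ∂P) atTop (nhds 0) := by
    have h0 : ∫ _, (0 : ℝ) ∂P = 0 := integral_zero α ℝ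
    nth_rewrite 2 [← h0]
    refine tendsto_integral_filter_of_dominated_convergence (fun a => X a ^ 2)
      (Eventually.of_forall hmeas) ?_ hX2 (ae_of_all _ fun a => ?_)
    · filter_upwards [eventually_ge_atTop 0] with M hM using ae_of_all _ (hbound M hM)
    · refine tendsto_const_nhds.congr' ?_
      filter_upwards [eventually_ge_atTop (X a)] with M hM
      simp [max_eq_right (sub_nonpos.mpr hM)]
  rw [← sub_zero ((∫ a, X a ^ 2 ∂P) / 2)]
  refine (tendsto_const_nhds.sub hlim).congr' ?_
  filter_upwards [eventually_ge_atTop 0] with M hM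
  have hsplit (a : α) : max (M - X a) 0 ^ 2 / 2 =
      (M ^ 2 / 2 - M * X a + X a ^ 2 / 2) - max (X a - M) 0 ^ 2 / 2 := by
    rcases le_total (X a) M with h | h
    · rw [max_eq_left (sub_nonneg.mpr h), max_eq_right (sub_nonpos.mpr h)]
      ring
    · rw [max_eq_right (sub_nonpos.mpr h), max_eq_left (sub_nonneg.mpr h)]
      ring
  have hi := hX1.const_mul M
  have hc : Integrable (fun _ : α => M ^ 2 / 2) P := integrable_const _
  have hq : Integrable (fun a => M ^ 2 / 2 - M * X a + X a ^ 2 / 2) P :=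
    (hc.sub hi).add (hX2.div_const 2)
  simp_rw [hsplit]
  rw [integral_sub hq
    (hX2.mono' (hmeas M) (ae_of_all _ (hbound M hM))),
    integral_add (f := fun a => M ^ 2 / 2 - M * X a) (hc.sub hi) (hX2.div_const 2),
    integral_sub hc hi, integral_const_mul,
    integral_const, probReal_univ, one_smul, integral_div, integral_div]
  ring

lemma setLIntegral_Ici_ofReal_sub (a d : ℝ) :
    ∫⁻ u in Set.Ici a, ENNReal.ofReal (d - u) = ENNReal.ofReal (max (d - a) 0 ^ 2 / 2) := by
  rcases le_total d a with h | h
  · rw [max_eq_right (by linarith), setLIntegral_congr_fun (g := 0) measurableSet_Ici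
      fun u hu => ENNReal.ofReal_of_nonpos (by linarith [Set.mem_Ici.mp hu])]
    simp
  · have hz : ∫⁻ u in Set.Ioi d, ENNReal.ofReal (d - u) = 0 := by
      rw [setLIntegral_congr_fun (g := 0) measurableSet_Ioi
        fun u hu => ENNReal.ofReal_of_nonpos (by linarith [Set.mem_Ioi.mp hu])]
      simp
    have hpos : 0 ≤ᵐ[volume.restrict (Set.Ioc a d)] fun u => d - u :=
      (ae_restrict_mem measurableSet_Ioc).mono fun u hu => sub_nonneg.mpr hu.2
    rw [max_eq_left (sub_nonneg.mpr h), ← Measure.restrict_congr_set Ioi_ae_eq_Ici,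
      ← Set.Ioc_union_Ioi_eq_Ioi h, lintegral_union measurableSet_Ioi
        (Set.disjoint_left.mpr fun x hx hx' => not_lt_of_ge hx.2 hx'), hz, add_zero,
      ← ofReal_integral_eq_lintegral_ofReal
        (Continuous.integrableOn_Ioc (by fun_prop)) hpos,
      ← intervalIntegral.integral_of_le h, intervalIntegral.integral_comp_sub_left (fun x => x) d]
    simp

/-- The area of a right triangle in terms of its legs. -/
lemma volume_triangle (a b c : ℝ) :
    volume {x : ℝ × ℝ | a ≤ x.1 ∧ b ≤ x.2 ∧ x.1 + x.2 ≤ c} =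
      ENNReal.ofReal (max (c - (a + b)) 0 ^ 2 / 2) := by
  have hm : MeasurableSet {x : ℝ × ℝ | a ≤ x.1 ∧ b ≤ x.2 ∧ x.1 + x.2 ≤ c} := by
    measurability
  rw [Measure.volume_eq_prod, Measure.prod_apply hm, show c - (a + b) = (c - b) - a by ring,
    ← setLIntegral_Ici_ofReal_sub, ← lintegral_indicator measurableSet_Ici]
  refine lintegral_congr fun u => ?_
  by_cases hu : a ≤ u
  · rw [Set.indicator_of_mem (Set.mem_Ici.mpr hu), show c - b - u = (c - u) - b by ring,
      ← Real.volume_Icc]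
    congr 1
    ext v
    simp only [Set.mem_preimage, Set.mem_ofPred_eq, Set.mem_Icc]
    grind
  · rw [Set.indicator_of_notMem (by simpa using hu)]
    convert! measure_empty (μ := (volume : Measure ℝ))
    ext v
    simp [hu]

/-- The integral of the mirror potential is the expected area of a triangle whose sides
are displaced by three independent Gumbel variables. -/
lemma integral_exp_neg_potential (M : ℝ) :
    ∫ x : ℝ × ℝ, Real.exp (-(Real.exp (-x.1) + Real.exp (-x.2) + Real.exp (-(M - x.1 - x.2)))) =
      ∫ g : ℝ × ℝ × ℝ, max (M - (g.1 + (g.2.1 + g.2.2))) 0 ^ 2 / 2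
        ∂gumbelMeasure.prod (gumbelMeasure.prod gumbelMeasure) := by
  rw [integral_eq_lintegral_of_nonneg_ae (ae_of_all _ fun x => (Real.exp_pos _).le)
    (by fun_prop), integral_eq_lintegral_of_nonneg_ae (ae_of_all _ fun x => by positivity)
    (Measurable.aestronglyMeasurable (by fun_prop))]
  congr 1
  set P := gumbelMeasure.prod (gumbelMeasure.prod gumbelMeasure)
  let S : Set ((ℝ × ℝ) × (ℝ × ℝ × ℝ)) :=
    {z | z.2.1 ≤ z.1.1 ∧ z.2.2.1 ≤ z.1.2 ∧ z.2.2.2 ≤ M - z.1.1 - z.1.2}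
  have hS : MeasurableSet S := by
    simp only [S]
    measurability
  have key := (Measure.prod_apply (μ := volume) (ν := P) hS).symm.trans
    (Measure.prod_apply_symm hS)
  convert! key using 2
  · ext x
    have : Prod.mk x ⁻¹' S = Set.Iic x.1 ×ˢ Set.Iic x.2 ×ˢ Set.Iic (M - x.1 - x.2) := rfl
    rw [this, Measure.prod_prod, Measure.prod_prod, gumbelMeasure_Iic, gumbelMeasure_Iic,
      gumbelMeasure_Iic, ← ENNReal.ofReal_mul (Real.exp_pos _).le,
      ← ENNReal.ofReal_mul (Real.exp_pos _).le, ← Real.exp_add, ← Real.exp_add]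
    congr 2
    ring
  · ext g
    rw [← add_assoc, show M - (g.1 + g.2.1 + g.2.2) = (M - g.2.2) - (g.1 + g.2.1) by ring,
      ← volume_triangle]
    congr 1
    ext x
    simp only [S, Set.mem_preimage, Set.mem_ofPred_eq]
    grind

lemma log_sq_mul_integral_eq (l1 l2 l3 : ℝ) {t : ℝ} (ht : 0 < t) (ht1 : t < 1) :
    Real.log t ^ 2 * (∫ x : ℝ × ℝ,
        Real.exp (-(t ^ (l1 + x.1) + t ^ (l2 + x.2) + t ^ (l3 - x.1 - x.2)))) =
      ∫ x : ℝ × ℝ, Real.exp (-(Real.exp (-x.1) + Real.exp (-x.2) +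
        Real.exp (-(-Real.log t * (l1 + l2 + l3) - x.1 - x.2)))) := by
  set F : ℝ × ℝ → ℝ := fun x => Real.exp (-(Real.exp (-x.1) + Real.exp (-x.2) +
        Real.exp (-(-Real.log t * (l1 + l2 + l3) - x.1 - x.2)))) with hF
  have hlog : Real.log t ≠ 0 := (Real.log_neg ht ht1).ne
  have h1 : ∀ x : ℝ × ℝ, Real.exp (-(t ^ (l1 + x.1) + t ^ (l2 + x.2) + t ^ (l3 - x.1 - x.2))) =
      F (-Real.log t • ((l1, l2) + x)) := by
    intro x
    simp only [hF, Real.rpow_def_of_pos ht, Prod.smul_fst, Prod.smul_snd, Prod.fst_add,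
      Prod.snd_add, smul_eq_mul]
    ring_nf
  simp_rw [h1]
  rw [integral_add_left_eq_self (fun x => F (-Real.log t • x)), Measure.integral_comp_smul]
  simp [hlog]

/-- Mirror-symmetric Gamma conjecture for ℙ² with structure sheaf insertion. -/
theorem gamma_conjecture_P2 (l1 l2 l3 : ℝ) (h1 : 0 < l1) (h2 : 0 < l2) (h3 : 0 < l3) :
    Tendsto (fun t : ℝ =>
        (Real.log t) ^ 2 *
            (∫ x : ℝ × ℝ,
              Real.exp (-(t ^ (l1 + x.1) + t ^ (l2 + x.2) + t ^ (l3 - x.1 - x.2)))) -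
          ((l1 + l2 + l3) ^ 2 / 2 * (Real.log t) ^ 2 +
            3 * (l1 + l2 + l3) * Real.eulerMascheroniConstant * Real.log t))
      (nhdsWithin 0 (Set.Ioi 0))
      (nhds (9 * Real.eulerMascheroniConstant ^ 2 / 2 + Real.pi ^ 2 / 4)) := by
  have hg := memLp_id_gumbelMeasure
  have hgg := hg.add_prod hg
  have hM : Tendsto (fun t : ℝ => -Real.log t * (l1 + l2 + l3)) (nhdsWithin 0 (Set.Ioi 0)) atTop :=
    (tendsto_neg_atBot_atTop.comp Real.tendsto_log_nhdsGT_zero).atTop_mul_const (by positivity)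
  have key := (tendsto_integral_posPart_sq (hg.add_prod hgg)).comp hM
  rw [integral_add_sq_prod hg hgg, integral_add_prod hg hgg, integral_add_sq_prod hg hg,
    integral_add_prod hg hg, integral_id_gumbelMeasure, integral_sq_gumbelMeasure] at key
  convert! key.congr' ?_ using 2
  · ring
  · filter_upwards [Ioo_mem_nhdsGT one_pos] with t ht
    rw [log_sq_mul_integral_eq l1 l2 l3 ht.1 ht.2, integral_exp_neg_potential,
      Function.comp_apply]
    ring
end
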